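/- Extend Ψ to ℤ by setting Ψ_m := 0 for m < 0, and define the autocovariance function γ : ℤ → Matrix (Fin n) (Fin n) ℝ by γ(h) := Σ_{m=0}^∞ Ψ_{m+h} Σ Ψ_mᵀ for h ≥ 0 and γ(h) := γ(−h)ᵀ for h < 0. Then for every ω ∈ ℝ, the two-sided Fourier series of the autocovariances equals the spectral density: Σ_{h ∈ ℤ} γ(h) e^{-iωh} = Ψ̂(ω) Σ Ψ̂(ω)^* (entrywise equality of complex matrices). -/

import Mathlib

open MeasureTheory Matrix

/-- Frequency response `Ψ̂(ω) = ∑_{h=0}^∞ e^{-iωh} Ψ_h`. -/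
noncomputable def freqResp {n : ℕ} (Ψ : ℕ → Matrix (Fin n) (Fin n) ℝ) (ω : ℝ) :
    Matrix (Fin n) (Fin n) ℂ :=
  ∑' h : ℕ, Complex.exp (-(Complex.I * ω * h)) • (Ψ h).map Complex.ofReal

/-- Spectral density `Ψ̂(ω) Σ Ψ̂(ω)^*`. -/
noncomputable def specDens {n : ℕ} (Ψ : ℕ → Matrix (Fin n) (Fin n) ℝ)
    (S : Matrix (Fin n) (Fin n) ℝ) (ω : ℝ) : Matrix (Fin n) (Fin n) ℂ :=
  freqResp Ψ ω * S.map Complex.ofReal * (freqResp Ψ ω)ᴴ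

/-- Autocovariance function `γ : ℤ → Matrix`, with `Ψ` extended by zero to
negative indices: `γ(h) = ∑_{m=0}^∞ Ψ_{m+h} Σ Ψ_mᵀ` for `h ≥ 0` and
`γ(h) = γ(−h)ᵀ` for `h < 0`. -/
noncomputable def acov {n : ℕ} (Ψ : ℕ → Matrix (Fin n) (Fin n) ℝ)
    (S : Matrix (Fin n) (Fin n) ℝ) (h : ℤ) : Matrix (Fin n) (Fin n) ℝ :=
  if 0 ≤ h then ∑' m : ℕ, Ψ (m + h.toNat) * S * (Ψ m)ᵀ
  else (∑' m : ℕ, Ψ (m + (-h).toNat) * S * (Ψ m)ᵀ)ᵀ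

section Summability

attribute [local instance] Matrix.linftyOpNormedRing Matrix.linftyOpNormedSpace

variable {𝕜 ι κ : Type*} [RCLike 𝕜] {n : ℕ}

theorem summable_norm_of_entries {A : ι → Matrix (Fin n) (Fin n) 𝕜}
    (hA : ∀ j k, Summable fun i => ‖A i j k‖) : Summable fun i => ‖A i‖ :=
  summable_norm_iff.2 <| Pi.summable.2 fun j => Pi.summable.2 fun k => (hA j k).of_norm

theorem hasSum_mul_mul_of_entries {A : ι → Matrix (Fin n) (Fin n) 𝕜}
    {B : κ → Matrix (Fin n) (Fin n) 𝕜} (S : Matrix (Fin n) (Fin n) 𝕜)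
    (hA : ∀ j k, Summable fun i => ‖A i j k‖) (hB : ∀ j k, Summable fun i => ‖B i j k‖) :
    HasSum (fun p : ι × κ => A p.1 * S * B p.2) ((∑' i, A i) * S * ∑' i, B i) := by
  have hA' := summable_norm_of_entries hA
  have hB' := summable_norm_of_entries hB
  have hAS : Summable fun i => ‖A i * S‖ :=
    summable_norm_iff.2 (hA'.of_norm.mul_right S)
  have h := (summable_mul_of_summable_norm hAS hB').hasSum
  rwa [← tsum_mul_tsum_of_summable_norm hAS hB', hA'.of_norm.tsum_mul_right] at h

theorem HasSum.tsum_prod_matrix {f : ι × κ → Matrix (Fin n) (Fin n) 𝕜}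
    {a : Matrix (Fin n) (Fin n) 𝕜} (hf : HasSum f a) : ∑' i, ∑' k, f (i, k) = a :=
  (hf.summable.tsum_prod).symm.trans hf.tsum_eq

theorem Summable.prod_factor_matrix {f : ι × κ → Matrix (Fin n) (Fin n) 𝕜}
    (hf : Summable f) (i : ι) : Summable fun k => f (i, k) :=
  hf.prod_factor i

end Summability

/-- Pairs of naturals, parametrized by their difference and their minimum. -/
def intProdNatEquiv : ℤ × ℕ ≃ ℕ × ℕ where
  toFun x := (x.2 + x.1.toNat, x.2 + (-x.1).toNat)
  invFun p := ((p.1 : ℤ) - p.2, min p.1 p.2)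
  left_inv x := by ext <;> (simp; try omega)
  right_inv p := by ext <;> simp <;> omega

theorem Matrix.map_ofReal_tsum {ι : Type*} {n : ℕ} {f : ι → Matrix (Fin n) (Fin n) ℝ}
    (hf : Summable f) :
    (∑' i, f i).map Complex.ofReal = ∑' i, (f i).map Complex.ofReal :=
  hf.map_tsum (Complex.ofRealHom.toAddMonoidHom.mapMatrix)
    (continuous_id.matrix_map Complex.continuous_ofReal)

theorem acov_eq_tsum {n : ℕ} (Ψ : ℕ → Matrix (Fin n) (Fin n) ℝ)
    {S : Matrix (Fin n) (Fin n) ℝ} (hS : S.IsSymm) (h : ℤ) :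
    acov Ψ S h = ∑' m : ℕ, Ψ (m + h.toNat) * S * (Ψ (m + (-h).toNat))ᵀ := by
  unfold acov
  split_ifs with h0
  · simp [Int.toNat_of_nonpos (neg_nonpos.2 h0)]
  · rw [Matrix.transpose_tsum]
    simp [Int.toNat_of_nonpos (not_le.1 h0).le, Matrix.transpose_mul, hS.eq, Matrix.mul_assoc]

/-- The two-sided Fourier series of the autocovariances equals the spectral
density: `∑_{h ∈ ℤ} γ(h) e^{-iωh} = Ψ̂(ω) Σ Ψ̂(ω)^*`. -/
theorem acov_fourier_series_eq_specDens {n : ℕ} (hn : 1 ≤ n)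
    (Ψ : ℕ → Matrix (Fin n) (Fin n) ℝ) (S : Matrix (Fin n) (Fin n) ℝ)
    (hΨ : ∀ j k : Fin n, Summable fun h : ℕ => |Ψ h j k|)
    (hsymm : S.IsSymm) (hpsd : S.PosSemidef) (ω : ℝ) :
    (∑' h : ℤ, Complex.exp (-(Complex.I * ω * h)) • (acov Ψ S h).map Complex.ofReal) =
      specDens Ψ S ω := by
  set A : ℕ → Matrix (Fin n) (Fin n) ℂ := fun h =>
    Complex.exp (-(Complex.I * ω * h)) • (Ψ h).map Complex.ofReal with hA
  have hnorm (h : ℕ) : ‖Complex.exp (-(Complex.I * ω * h))‖ = 1 := by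
    simp [Complex.norm_exp]
  have hsum := hasSum_mul_mul_of_entries (A := A) (B := fun m => (A m)ᴴ)
    (S.map Complex.ofReal) (fun j k => by simpa [hA, hnorm] using hΨ j k)
    (fun j k => by simpa [hA, hnorm] using hΨ k j)
  rw [← Matrix.conjTranspose_tsum, ← intProdNatEquiv.hasSum_iff] at hsum
  have hreal := (intProdNatEquiv.summable_iff.2 (hasSum_mul_mul_of_entries (A := Ψ)
    (B := fun m => (Ψ m)ᵀ) S hΨ (fun j k => hΨ k j)).summable)
  refine Eq.trans (tsum_congr fun h => ?_) hsum.tsum_prod_matrix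
  have hterm := hreal.prod_factor_matrix h
  have hmap := Matrix.map_ofReal_tsum hterm
  simp only [intProdNatEquiv, Function.comp_apply, Equiv.coe_fn_mk] at hmap ⊢
  rw [acov_eq_tsum Ψ hsymm, hmap, ← tsum_const_smul'']
  refine tsum_congr fun m => ?_
  have hexp : Complex.exp (-(Complex.I * ω * h)) =
      Complex.exp (-(Complex.I * ω * (m + h.toNat : ℕ))) *
        star (Complex.exp (-(Complex.I * ω * (m + (-h).toNat : ℕ)))) := by
    have hh : (h : ℂ) = (m + h.toNat : ℕ) - (m + (-h).toNat : ℕ) := by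
      have : h = (m + h.toNat : ℕ) - (m + (-h).toNat : ℕ) := by omega
      exact_mod_cast congrArg (Int.cast : ℤ → ℂ) this
    rw [Complex.star_def, ← Complex.exp_conj, ← Complex.exp_add, hh]
    congr 1
    simp only [map_neg, map_mul, Complex.conj_I, Complex.conj_ofReal, map_natCast]
    ring
  have hconj : ((Ψ (m + (-h).toNat)).map Complex.ofReal)ᴴ =
      ((Ψ (m + (-h).toNat))ᵀ).map Complex.ofReal := by
    ext; simp
  have hmul (M N : Matrix (Fin n) (Fin n) ℝ) :
      (M * N).map Complex.ofReal = M.map Complex.ofReal * N.map Complex.ofReal :=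
    Matrix.map_mul (f := Complex.ofRealHom)
  rw [hexp, hA]
  simp only [Matrix.conjTranspose_smul, hconj, hmul, smul_mul_assoc, mul_smul_comm, smul_smul]
  rw [mul_comm]
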